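/- Let p be an odd prime and let b, c be integers with d = b^2 - 4c not divisible by p. Then the congruence ∑_{k=0}^{p-1} T_k(b,c)^2 / (-d)^k ≡ ∑_{l=0}^{(p-1)/2} binom(2l,l)^2 · (-c/(4d))^l (mod p^2) holds (both sides being p-adic integers, since p ∤ d so that -d and 4d are invertible modulo p^2). -/

import Mathlib

/-- The generalized central trinomial coefficient `T_n(b,c)`, the coefficient of `x^n`
in `(x^2 + b*x + c)^n`. -/
def genCentralTrinomial (b c : ℤ) (n : ℕ) : ℤ :=
  ∑ k ∈ Finset.range (n / 2 + 1),
    (n.choose (2 * k) : ℤ) * ((2 * k).choose k : ℤ) * b ^ (n - 2 * k) * c ^ k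

section Choose

variable {K : Type*} [Field K] [CharZero K]

theorem cast_choose_succ_right (n k : ℕ) :
    (n.choose (k + 1) : K) = n.choose k * ((n : K) - k) / (k + 1) := by
  have hk : (k + 1 : K) ≠ 0 := Nat.cast_add_one_ne_zero k
  rw [eq_div_iff hk]
  rcases le_or_gt k n with h | h
  · have := Nat.choose_succ_right_eq n k
    rw [← Nat.cast_sub h]
    exact_mod_cast this
  · simp [Nat.choose_eq_zero_of_lt h, Nat.choose_eq_zero_of_lt (Nat.lt_succ_of_lt h)]

omit [CharZero K] in
theorem cast_choose_succ_succ (n k : ℕ) :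
    ((n + 1).choose (k + 1) : K) = n.choose k + n.choose (k + 1) := by
  rw [Nat.choose_succ_succ]; push_cast; rfl

theorem cast_choose_two_mul_succ (k : ℕ) :
    ((2 * (k + 1)).choose (k + 1) : K) = 2 * (2 * k + 1) / (k + 1) * (2 * k).choose k := by
  have hk : (k + 1 : K) ≠ 0 := Nat.cast_add_one_ne_zero k
  have h := Nat.succ_mul_centralBinom_succ k
  simp only [Nat.centralBinom_eq_two_mul_choose] at h
  have h' : (k + 1 : K) * (2 * (k + 1)).choose (k + 1) = 2 * (2 * k + 1) * (2 * k).choose k := by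
    exact_mod_cast h
  field_simp
  linear_combination h'

theorem trinomial_coeff_recurrence (n k : ℕ) :
    ((n : K) + 2) * ((n + 2).choose (2 * (k + 1)) * (2 * (k + 1)).choose (k + 1)) =
      (2 * n + 3) * ((n + 1).choose (2 * (k + 1)) * (2 * (k + 1)).choose (k + 1)) -
        (n + 1) * (n.choose (2 * (k + 1)) * (2 * (k + 1)).choose (k + 1)) +
        4 * (n + 1) * (n.choose (2 * k) * (2 * k).choose k) := by
  rw [cast_choose_two_mul_succ]
  have e : 2 * (k + 1) = 2 * k + 1 + 1 := by ring
  rw [e]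
  simp only [cast_choose_succ_succ, cast_choose_succ_right]
  have hk : (k + 1 : K) ≠ 0 := Nat.cast_add_one_ne_zero k
  have hk1 : (2 * k + 1 : K) ≠ 0 := by exact_mod_cast Nat.succ_ne_zero (2 * k)
  have hk2 : (2 * k + 1 + 1 : K) ≠ 0 := by exact_mod_cast Nat.succ_ne_zero (2 * k + 1)
  push_cast
  field_simp
  ring

theorem sq_coeff_recurrence (n k : ℕ) :
    ((n : K) + 2) ^ 2 * (((2 * (k + 1)).choose (k + 1) : K) ^ 2 *
        (n + 2 + (k + 1)).choose (2 * (k + 1))) =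
      (2 * n + 3) ^ 2 * (((2 * (k + 1)).choose (k + 1) : K) ^ 2 *
        (n + 1 + (k + 1)).choose (2 * (k + 1))) +
      4 * (2 * n + 3) ^ 2 * (((2 * k).choose k : K) ^ 2 * (n + 1 + k).choose (2 * k)) -
      2 * (2 * n + 3) * (((2 * (k + 1)).choose (k + 1) : K) ^ 2 *
        ((2 * (k + 1 : ℕ) + 1) * (n + 1 + (k + 1)).choose (2 * (k + 1) + 1))) -
      8 * (2 * n + 3) * (((2 * k).choose k : K) ^ 2 *
        ((2 * k + 1) * (n + 1 + k).choose (2 * k + 1))) +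
      (n + 1) ^ 2 * (((2 * (k + 1)).choose (k + 1) : K) ^ 2 *
        (n + (k + 1)).choose (2 * (k + 1))) := by
  rw [cast_choose_two_mul_succ]
  have e : 2 * (k + 1) = 2 * k + 1 + 1 := by ring
  have e1 : n + 2 + (k + 1) = n + 1 + k + 1 + 1 := by ring
  have e2 : n + 1 + (k + 1) = n + 1 + k + 1 := by ring
  have e3 : n + (k + 1) = n + 1 + k := by ring
  rw [e, e1, e2, e3]
  simp only [cast_choose_succ_succ, cast_choose_succ_right]
  have hk : (k + 1 : K) ≠ 0 := Nat.cast_add_one_ne_zero k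
  have hk1 : (2 * k + 1 : K) ≠ 0 := by exact_mod_cast Nat.succ_ne_zero (2 * k)
  have hk2 : (2 * k + 1 + 1 : K) ≠ 0 := by exact_mod_cast Nat.succ_ne_zero (2 * k + 1)
  have hk3 : (2 * k + 3 : K) ≠ 0 := by exact_mod_cast Nat.succ_ne_zero (2 * k + 2)
  push_cast
  rw [show (2 * k + 2 + 1 : K) = 2 * k + 3 by ring]
  field_simp
  ring

theorem choose_add_succ_add_choose (n k : ℕ) :
    (2 * (k : K) + 1) * (n + 1 + k).choose (2 * k + 1) +
      (2 * k + 1) * (n + k).choose (2 * k + 1) = (2 * n + 1) * (n + k).choose (2 * k) := by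
  have e : n + 1 + k = n + k + 1 := by ring
  have hk1 : (2 * k + 1 : K) ≠ 0 := by exact_mod_cast Nat.succ_ne_zero (2 * k)
  rw [e]
  simp only [cast_choose_succ_succ, cast_choose_succ_right]
  push_cast
  field_simp
  ring

end Choose

section SquareFormula

variable {K : Type*} [Field K] [CharZero K]

/-- The polynomial `∑_{k < M} binom(2k,k)^2 binom(n+k,2k) x^k`, which for `n < M` is the square of
the Legendre polynomial `P_n` at `√(1 + 4x)`. -/
def legendreSq (M : ℕ) (x : K) (n : ℕ) : K :=
  ∑ k ∈ Finset.range M, (((2 * k).choose k : K) ^ 2 * (n + k).choose (2 * k)) * x ^ k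

/-- The polynomial `∑_{k < M} (2k+1) binom(2k,k)^2 binom(n+k,2k+1) x^k`, which for `n < M` is
`n P_n P_{n-1} / √(1 + 4x)` at `√(1 + 4x)`, where `P_n` is the Legendre polynomial. -/
def legendreMul (M : ℕ) (x : K) (n : ℕ) : K :=
  ∑ k ∈ Finset.range M,
    (((2 * k).choose k : K) ^ 2 * ((2 * k + 1) * (n + k).choose (2 * k + 1))) * x ^ k

theorem legendreMul_succ (M : ℕ) (x : K) (n : ℕ) :
    legendreMul M x (n + 1) = (2 * n + 1) * legendreSq M x n - legendreMul M x n := by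
  simp only [legendreMul, legendreSq, Finset.mul_sum, ← Finset.sum_sub_distrib]
  refine Finset.sum_congr rfl fun k _ => ?_
  linear_combination ((2 * k).choose k : K) ^ 2 * x ^ k * choose_add_succ_add_choose (K := K) n k

theorem legendreSq_recurrence {M n : ℕ} (h : n + 2 < M) (x : K) :
    ((n : K) + 2) ^ 2 * legendreSq M x (n + 2) =
      (1 + 4 * x) * ((2 * n + 3) ^ 2 * legendreSq M x (n + 1) -
        2 * (2 * n + 3) * legendreMul M x (n + 1)) + (n + 1) ^ 2 * legendreSq M x n := by
  obtain ⟨L, rfl⟩ : ∃ L, M = L + 1 := ⟨M - 1, by omega⟩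
  have hA : legendreSq (L + 1) x (n + 1) = ∑ k ∈ Finset.range L,
      (((2 * k).choose k : K) ^ 2 * (n + 1 + k).choose (2 * k)) * x ^ k := by
    rw [legendreSq, Finset.sum_range_succ,
      Nat.choose_eq_zero_of_lt (show n + 1 + L < 2 * L by omega)]
    simp
  have hY : legendreMul (L + 1) x (n + 1) = ∑ k ∈ Finset.range L,
      (((2 * k).choose k : K) ^ 2 * ((2 * k + 1) * (n + 1 + k).choose (2 * k + 1))) * x ^ k := by
    rw [legendreMul, Finset.sum_range_succ,
      Nat.choose_eq_zero_of_lt (show n + 1 + L < 2 * L + 1 by omega)]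
    simp
  suffices ((n : K) + 2) ^ 2 * legendreSq (L + 1) x (n + 2) -
      (2 * n + 3) ^ 2 * legendreSq (L + 1) x (n + 1) +
        2 * (2 * n + 3) * legendreMul (L + 1) x (n + 1) -
        (n + 1) ^ 2 * legendreSq (L + 1) x n =
      4 * x * (2 * n + 3) ^ 2 * legendreSq (L + 1) x (n + 1) -
        8 * x * (2 * n + 3) * legendreMul (L + 1) x (n + 1) by
    linear_combination this
  conv_rhs => rw [hA, hY]
  clear hA hY
  simp only [legendreSq, legendreMul, Finset.mul_sum, ← Finset.sum_add_distrib,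
    ← Finset.sum_sub_distrib]
  rw [Finset.sum_range_succ']
  refine (congrArg₂ (· + ·) (Finset.sum_congr rfl fun k _ => ?_) ?_).trans (add_zero _)
  · linear_combination x ^ (k + 1) * sq_coeff_recurrence (K := K) n k
  · simp
    ring

theorem genCentralTrinomial_cast_eq (b c : ℤ) {M n : ℕ} (h : n < 2 * M) :
    (genCentralTrinomial b c n : K) = ∑ k ∈ Finset.range M,
      ((n.choose (2 * k) * (2 * k).choose k : K) * (b : K) ^ (n - 2 * k)) * (c : K) ^ k := by
  rw [genCentralTrinomial]
  push_cast
  refine Finset.sum_subset (fun k hk => ?_) (fun k _ hk => ?_)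
  · simp only [Finset.mem_range] at *; omega
  · simp only [Finset.mem_range] at hk
    rw [Nat.choose_eq_zero_of_lt (show n < 2 * k by omega)]
    simp

theorem choose_mul_pow_add_sub (b : K) (m n k : ℕ) :
    (n.choose k : K) * b ^ (n + m - k) = b ^ m * (n.choose k * b ^ (n - k)) := by
  rcases le_or_gt k n with h | h
  · rw [show n + m - k = m + (n - k) by omega, pow_add]; ring
  · simp [Nat.choose_eq_zero_of_lt h]

theorem genCentralTrinomial_recurrence (b c : ℤ) (n : ℕ) :
    ((n : K) + 2) * genCentralTrinomial b c (n + 2) =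
      (2 * n + 3) * b * genCentralTrinomial b c (n + 1) -
        (n + 1) * ((b : K) ^ 2 - 4 * c) * genCentralTrinomial b c n := by
  have e2 := genCentralTrinomial_cast_eq (K := K) b c (show n + 2 < 2 * (n + 2 + 1) by omega)
  have e1 := genCentralTrinomial_cast_eq (K := K) b c (show n + 1 < 2 * (n + 2 + 1) by omega)
  have e0 := genCentralTrinomial_cast_eq (K := K) b c (show n < 2 * (n + 2 + 1) by omega)
  have e0' := genCentralTrinomial_cast_eq (K := K) b c (show n < 2 * (n + 2) by omega)
  suffices ((n : K) + 2) * genCentralTrinomial b c (n + 2) -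
      (2 * n + 3) * b * genCentralTrinomial b c (n + 1) +
        (n + 1) * (b : K) ^ 2 * genCentralTrinomial b c n =
        4 * (n + 1) * c * genCentralTrinomial b c n by
    linear_combination this
  conv_rhs => rw [e0']
  rw [e0, e1, e2]
  simp only [Finset.mul_sum, ← Finset.sum_add_distrib, ← Finset.sum_sub_distrib]
  rw [Finset.sum_range_succ']
  have hz : ((n : K) + 2) * (((n + 2).choose (2 * 0) * (2 * 0).choose 0 : K) *
      (b : K) ^ (n + 2 - 2 * 0) * (c : K) ^ 0) -
      (2 * n + 3) * b * (((n + 1).choose (2 * 0) * (2 * 0).choose 0 : K) *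
      (b : K) ^ (n + 1 - 2 * 0) * (c : K) ^ 0) +
      (n + 1) * (b : K) ^ 2 * ((n.choose (2 * 0) * (2 * 0).choose 0 : K) *
      (b : K) ^ (n - 2 * 0) * (c : K) ^ 0) = 0 := by
    simp; ring
  rw [hz, add_zero]
  refine Finset.sum_congr rfl fun k _ => ?_
  have h1 := choose_mul_pow_add_sub (b : K) 1 (n + 1) (2 * (k + 1))
  have h0 := choose_mul_pow_add_sub (b : K) 2 n (2 * (k + 1))
  rw [show n + 1 + 1 - 2 * (k + 1) = n - 2 * k by omega] at h1
  rw [show n + 2 - 2 * (k + 1) = n - 2 * k by omega] at h0 ⊢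
  linear_combination (b : K) ^ (n - 2 * k) * c ^ (k + 1) * trinomial_coeff_recurrence (K := K) n k
    + (2 * n + 3) * (2 * (k + 1)).choose (k + 1) * c ^ (k + 1) * h1
    - (n + 1) * (2 * (k + 1)).choose (k + 1) * c ^ (k + 1) * h0

theorem legendreSq_zero {M : ℕ} (h : 0 < M) (x : K) : legendreSq M x 0 = 1 := by
  obtain ⟨L, rfl⟩ : ∃ L, M = L + 1 := ⟨M - 1, by omega⟩
  rw [legendreSq, Finset.sum_range_succ', Finset.sum_eq_zero]
  · simp
  · intro k _
    rw [Nat.choose_eq_zero_of_lt (show 0 + (k + 1) < 2 * (k + 1) by omega)]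
    simp

theorem legendreSq_one {M : ℕ} (h : 1 < M) (x : K) : legendreSq M x 1 = 1 + 4 * x := by
  obtain ⟨L, rfl⟩ : ∃ L, M = L + 1 + 1 := ⟨M - 2, by omega⟩
  rw [legendreSq, Finset.sum_range_succ', Finset.sum_range_succ', Finset.sum_eq_zero]
  · norm_num; ring
  · intro k _
    rw [Nat.choose_eq_zero_of_lt (show 1 + (k + 1 + 1) < 2 * (k + 1 + 1) by omega)]
    simp

theorem legendreMul_zero (M : ℕ) (x : K) : legendreMul M x 0 = 0 := by
  refine Finset.sum_eq_zero fun k _ => ?_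
  rw [Nat.choose_eq_zero_of_lt (show 0 + k < 2 * k + 1 by omega)]
  simp

theorem genCentralTrinomial_sq_aux (b c : ℤ) {d x : K} (hd : d = (b : K) ^ 2 - 4 * c)
    (hx : d * x = c) {M : ℕ} (n : ℕ) (hn : n + 1 < M) :
    (genCentralTrinomial b c n : K) ^ 2 = d ^ n * legendreSq M x n ∧
    (genCentralTrinomial b c (n + 1) : K) ^ 2 = d ^ (n + 1) * legendreSq M x (n + 1) ∧
    ((n : K) + 1) * genCentralTrinomial b c (n + 1) * genCentralTrinomial b c n =
      b * d ^ n * legendreMul M x (n + 1) := by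
  have hb : (b : K) ^ 2 = d * (1 + 4 * x) := by linear_combination -hd - 4 * hx
  induction n with
  | zero =>
    have h0 : genCentralTrinomial b c 0 = 1 := by simp [genCentralTrinomial]
    have h1 : genCentralTrinomial b c 1 = b := by simp [genCentralTrinomial]
    simp only [zero_add] at hn ⊢
    rw [h0, h1, legendreSq_zero (by omega), legendreSq_one hn]
    have hY := legendreMul_succ M x 0
    rw [legendreSq_zero (by omega), legendreMul_zero] at hY
    simp only [zero_add] at hY
    rw [hY, hb]
    simp
  | succ n ih =>
    obtain ⟨i0, i1, i2⟩ := ih (by omega)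
    have hr := genCentralTrinomial_recurrence (K := K) b c n
    rw [← hd] at hr
    have hn2 : ((n : K) + 2) ≠ 0 := by exact_mod_cast Nat.succ_ne_zero (n + 1)
    refine ⟨i1, ?_, ?_⟩
    · have hA := legendreSq_recurrence (K := K) (show n + 2 < M from hn) x
      apply mul_left_cancel₀ (pow_ne_zero 2 hn2)
      calc ((n : K) + 2) ^ 2 * (genCentralTrinomial b c (n + 1 + 1) : K) ^ 2
          = (((n : K) + 2) * (genCentralTrinomial b c (n + 2) : K)) ^ 2 := by ring
        _ = (2 * n + 3) ^ 2 * (b : K) ^ 2 * (genCentralTrinomial b c (n + 1) : K) ^ 2 -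
            2 * (2 * n + 3) * b * d * (((n : K) + 1) * genCentralTrinomial b c (n + 1) *
              genCentralTrinomial b c n) +
            (n + 1) ^ 2 * d ^ 2 * (genCentralTrinomial b c n : K) ^ 2 := by rw [hr]; ring
        _ = d ^ (n + 1 + 1) * (((n : K) + 2) ^ 2 * legendreSq M x (n + 2)) := by
          rw [hA, i0, i1, i2]
          linear_combination ((2 * n + 3) ^ 2 * d ^ (n + 1) * legendreSq M x (n + 1) -
            2 * (2 * n + 3) * d ^ (n + 1) * legendreMul M x (n + 1)) * hb
        _ = _ := by ring
    · have hY := legendreMul_succ M x (n + 1)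
      rw [hY]
      push_cast
      linear_combination (genCentralTrinomial b c (n + 1) : K) * hr + (2 * n + 3) * b * i1 - d * i2

theorem genCentralTrinomial_sq (b c : ℤ) {d x : K} (hd : d = (b : K) ^ 2 - 4 * c)
    (hx : d * x = c) {M n : ℕ} (hM : 1 < M) (hn : n < M) :
    (genCentralTrinomial b c n : K) ^ 2 = d ^ n * legendreSq M x n := by
  rcases n with _ | n
  · exact (genCentralTrinomial_sq_aux b c hd hx 0 hM).1
  · exact (genCentralTrinomial_sq_aux b c hd hx n hn).2.1

end SquareFormula

/-- The alternating sum `∑_{n < N} (-1)^n binom(n+k,2k)`. -/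
def altChooseSum (N k : ℕ) : ℤ :=
  ∑ n ∈ Finset.range N, (-1) ^ n * ((n + k).choose (2 * k) : ℤ)

theorem altChooseSum_succ_right (N k : ℕ) :
    4 * altChooseSum N (k + 1) + altChooseSum N k =
      -(-1) ^ N * ((N + k + 1).choose (2 * k + 2) + (N + k).choose (2 * k + 2) : ℤ) := by
  induction N with
  | zero =>
    rw [Nat.choose_eq_zero_of_lt (show 0 + k + 1 < 2 * k + 2 by omega),
      Nat.choose_eq_zero_of_lt (show 0 + k < 2 * k + 2 by omega)]
    simp [altChooseSum]
  | succ N ih =>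
    rw [altChooseSum, altChooseSum, Finset.sum_range_succ, Finset.sum_range_succ,
      ← altChooseSum, ← altChooseSum]
    rw [show N + 1 + k + 1 = N + k + 1 + 1 by ring, show N + 1 + k = N + k + 1 by ring,
      show N + (k + 1) = N + k + 1 by ring, show 2 * (k + 1) = 2 * k + 1 + 1 by ring]
    simp only [Nat.choose_succ_succ (N + k + 1), Nat.choose_succ_succ (N + k)] at ih ⊢
    push_cast at ih ⊢
    rw [pow_succ]
    linear_combination ih

theorem sq_dvd_choose_add_choose {p k : ℕ} (hp : p.Prime) (hk : 2 * k + 2 < p) :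
    p ^ 2 ∣ (p + k + 1).choose (2 * k + 2) + (p + k).choose (2 * k + 2) := by
  have hc : Nat.Coprime (p ^ 2) (k + 1) :=
    Nat.Coprime.pow_left 2 (Nat.coprime_of_lt_prime (by omega) (by omega) hp)
  refine hc.dvd_of_dvd_mul_left ?_
  have h : (k + 1) * ((p + k + 1).choose (2 * k + 2) + (p + k).choose (2 * k + 2)) =
      p * (p + k).choose (2 * k + 1) := by
    have : ((k + 1 : ℚ)) * ((p + k + 1).choose (2 * k + 2) + (p + k).choose (2 * k + 2)) =
        p * (p + k).choose (2 * k + 1) := by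
      have hk2 : (2 * k + 1 + 1 : ℚ) ≠ 0 := by positivity
      rw [cast_choose_succ_succ, cast_choose_succ_right (p + k) (2 * k + 1)]
      push_cast
      field_simp
      ring
    exact_mod_cast this
  rw [h, sq]
  refine mul_dvd_mul_left p ?_
  have := hp.dvd_choose_add (a := 2 * k + 1) (b := p - k - 1) (by omega) (by omega) (by omega)
  rwa [show 2 * k + 1 + (p - k - 1) = p + k by omega] at this

section Padic

variable {p : ℕ} [Fact p.Prime]

theorem norm_intCast_le_of_sq_dvd {z : ℤ} (h : (p : ℤ) ^ 2 ∣ z) :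
    ‖(z : ℚ_[p])‖ ≤ (p : ℝ)⁻¹ ^ 2 := by
  have := (Padic.norm_int_le_pow_iff_dvd z 2).2 (by exact_mod_cast h)
  simpa [zpow_neg] using this

theorem norm_four_of_odd (hodd : Odd p) : ‖(4 : ℚ_[p])‖ = 1 := by
  have hp : p.Prime := Fact.out
  have h : ‖((4 : ℕ) : ℚ_[p])‖ = 1 := by
    rw [Padic.norm_natCast_eq_one_iff]
    exact Nat.Coprime.pow_right 2 (Nat.coprime_two_right.2 hodd)
  exact_mod_cast h

theorem norm_altChooseSum_sub_le (hodd : Odd p) (k : ℕ) (hk : 2 * k < p) :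
    ‖(altChooseSum p k : ℚ_[p]) - (-1 / 4) ^ k‖ ≤ (p : ℝ)⁻¹ ^ 2 := by
  have hp : p.Prime := Fact.out
  induction k with
  | zero =>
    have : altChooseSum p 0 = 1 := by
      simp [altChooseSum, Finset.sum_range, Fin.sum_neg_one_pow, Nat.not_even_iff_odd.2 hodd]
    rw [this]
    simp
  | succ k ih =>
    have h4 := norm_four_of_odd hodd
    have h40 : (4 : ℚ_[p]) ≠ 0 := by norm_num
    set B : ℕ := (p + k + 1).choose (2 * k + 2) + (p + k).choose (2 * k + 2) with hB
    have hr := altChooseSum_succ_right p k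
    rw [hodd.neg_one_pow, neg_neg, one_mul] at hr
    have hr' : 4 * (altChooseSum p (k + 1) : ℚ_[p]) + altChooseSum p k = ((B : ℤ) : ℚ_[p]) := by
      rw [hB]; exact_mod_cast hr
    have hBn : ‖((B : ℤ) : ℚ_[p])‖ ≤ (p : ℝ)⁻¹ ^ 2 :=
      norm_intCast_le_of_sq_dvd (by exact_mod_cast sq_dvd_choose_add_choose hp (by omega))
    have e : 4 * ((altChooseSum p (k + 1) : ℚ_[p]) - (-1 / 4) ^ (k + 1)) =
        ((B : ℤ) : ℚ_[p]) - ((altChooseSum p k : ℚ_[p]) - (-1 / 4) ^ k) := by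
      rw [← hr', pow_succ]
      ring
    calc _ = ‖4 * ((altChooseSum p (k + 1) : ℚ_[p]) - (-1 / 4) ^ (k + 1))‖ := by
          rw [norm_mul, h4, one_mul]
      _ ≤ _ := by
        rw [e, sub_eq_add_neg]
        exact (IsUltrametricDist.norm_add_le_max _ _).trans
          (max_le hBn (by rw [norm_neg]; exact ih (by omega)))

end Padic

theorem sum_sq_div_neg_d_pow (p : ℕ) [Fact p.Prime] (hodd : Odd p) (b c d : ℤ)
    (hd : d = b ^ 2 - 4 * c) (hpd : ¬ (p : ℤ) ∣ d) :
    ‖(∑ k ∈ Finset.range p,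
        (genCentralTrinomial b c k : ℚ_[p]) ^ 2 / (-(d : ℚ_[p])) ^ k) -
      ∑ l ∈ Finset.range ((p - 1) / 2 + 1),
        ((2 * l).choose l : ℚ_[p]) ^ 2 * (-(c : ℚ_[p]) / (4 * (d : ℚ_[p]))) ^ l‖ ≤
      (p : ℝ)⁻¹ ^ 2 := by
  have hp : p.Prime := Fact.out
  have hdn : ‖(d : ℚ_[p])‖ = 1 :=
    le_antisymm (Padic.norm_int_le_one d)
      (not_lt.1 fun h => hpd ((Padic.norm_intCast_lt_one_iff).1 h))
  have hd0 : (d : ℚ_[p]) ≠ 0 := by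
    intro h; rw [h] at hdn; simp at hdn
  set x : ℚ_[p] := (c : ℚ_[p]) / d with hx
  have hxn : ‖x‖ ≤ 1 := by
    rw [hx, norm_div, hdn, div_one]; exact Padic.norm_int_le_one c
  have hdx : (d : ℚ_[p]) * x = c := by rw [hx]; field_simp
  have hleft : (∑ k ∈ Finset.range p,
      (genCentralTrinomial b c k : ℚ_[p]) ^ 2 / (-(d : ℚ_[p])) ^ k) =
      ∑ k ∈ Finset.range p, ((2 * k).choose k : ℚ_[p]) ^ 2 * x ^ k * altChooseSum p k := by
    have h1 : ∀ n ∈ Finset.range p,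
        (genCentralTrinomial b c n : ℚ_[p]) ^ 2 / (-(d : ℚ_[p])) ^ n =
        ∑ k ∈ Finset.range p, ((2 * k).choose k : ℚ_[p]) ^ 2 * x ^ k *
          ((-1) ^ n * (n + k).choose (2 * k)) := by
      intro n hn
      rw [genCentralTrinomial_sq b c (by rw [hd]; push_cast; rfl) hdx hp.one_lt
        (Finset.mem_range.1 hn), neg_pow, mul_comm ((-1) ^ n), mul_div_mul_left _ _
        (pow_ne_zero n hd0), legendreSq, Finset.sum_div]
      refine Finset.sum_congr rfl fun k _ => ?_
      rcases neg_one_pow_eq_or ℚ_[p] n with h | h <;> rw [h] <;> ring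
    rw [Finset.sum_congr rfl h1, Finset.sum_comm]
    refine Finset.sum_congr rfl fun k _ => ?_
    rw [← Finset.mul_sum, altChooseSum]
    push_cast
    rfl
  have hpos : (0 : ℝ) ≤ (p : ℝ)⁻¹ ^ 2 := by positivity
  have hp1 := hp.one_lt
  have hsplit : p = ((p - 1) / 2 + 1) + (p - ((p - 1) / 2 + 1)) := by omega
  rw [hleft]
  conv_lhs => enter [1, 1, 1]; rw [hsplit]
  rw [Finset.sum_range_add, add_sub_right_comm, ← Finset.sum_sub_distrib]
  have hterm : ∀ (k : ℕ) (z : ℚ_[p]), ‖((2 * k).choose k : ℚ_[p])‖ ^ 2 * ‖z‖ ≤ (p : ℝ)⁻¹ ^ 2 →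
      ‖((2 * k).choose k : ℚ_[p]) ^ 2 * x ^ k * z‖ ≤ (p : ℝ)⁻¹ ^ 2 := by
    intro k z h
    calc ‖((2 * k).choose k : ℚ_[p]) ^ 2 * x ^ k * z‖
        = (‖((2 * k).choose k : ℚ_[p])‖ ^ 2 * ‖z‖) * ‖x‖ ^ k := by
          simp only [norm_mul, norm_pow]; ring
      _ ≤ (p : ℝ)⁻¹ ^ 2 * 1 :=
          mul_le_mul h (pow_le_one₀ (norm_nonneg x) hxn) (by positivity) hpos
      _ = _ := mul_one _
  refine (IsUltrametricDist.norm_add_le_max _ _).trans (max_le ?_ ?_)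
  · refine IsUltrametricDist.norm_sum_le_of_forall_le_of_nonneg hpos fun k hk => ?_
    have hk' : 2 * k < p := by
      have := Finset.mem_range.1 hk
      obtain ⟨m, rfl⟩ := hodd
      omega
    have e : -(c : ℚ_[p]) / (4 * (d : ℚ_[p])) = x * (-1 / 4) := by
      rw [hx]; field_simp
    rw [e, mul_pow, ← mul_assoc, ← mul_sub]
    refine hterm k _ ?_
    refine (mul_le_of_le_one_left (norm_nonneg _) ?_).trans (norm_altChooseSum_sub_le hodd k hk')
    exact pow_le_one₀ (norm_nonneg _) (by exact_mod_cast Padic.norm_int_le_one _)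
  · refine IsUltrametricDist.norm_sum_le_of_forall_le_of_nonneg hpos fun j hj => ?_
    set k := (p - 1) / 2 + 1 + j with hk
    have hj' := Finset.mem_range.1 hj
    have hdvd : p ∣ (2 * k).choose k := by
      rw [two_mul]
      exact hp.dvd_choose_add (by omega) (by omega) (by omega)
    refine hterm k _ ?_
    rw [← norm_pow]
    refine (mul_le_of_le_one_right (norm_nonneg _) (Padic.norm_int_le_one _)).trans ?_
    have := norm_intCast_le_of_sq_dvd (p := p) (z := ((2 * k).choose k : ℤ) ^ 2)
      (pow_dvd_pow_of_dvd (by exact_mod_cast hdvd) 2)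
    exact_mod_cast this
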